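/- arXiv:1702.06997 — 2 statements merged into one kernel-verified Lean document; each statement's English description precedes it below -/
import Mathlib

section
/- For all naturals n, s, N, terms T : Fin N → (Fin s → Fin n), clauses C : Fin N → Fin N → (Fin s → Fin n), a string x, and a coordinate k : Fin n, suppose that Γ_{T,C}(x) = (i, j), that x k = false, that k is not in the range of the clause C i j (event E₁), and that for every i' ≠ i the flipped string x^(k) does not satisfy the term T i' (event E₂). Then Γ_{T,C}(x^(k)) = (i, j). -/
open scoped Classical

/-- `x` satisfies the term `T` if all variables of `T` are true in `x`. -/
def Satisfies {n s : ℕ} (x : Fin n → Bool) (T : Fin s → Fin n) : Prop :=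
  ∀ m, x (T m) = true

/-- `x` falsifies the clause `Cl` if all variables of `Cl` are false in `x`. -/
def Falsifies {n s : ℕ} (x : Fin n → Bool) (Cl : Fin s → Fin n) : Prop :=
  ∀ m, x (Cl m) = false

/-- `x` with coordinate `k` flipped. -/
def flipCoord {n : ℕ} (x : Fin n → Bool) (k : Fin n) : Fin n → Bool :=
  Function.update x k (!x k)

/-- The number of true coordinates of `x`. -/
def weight {n : ℕ} (x : Fin n → Bool) : ℕ :=
  (Finset.univ.filter fun k => x k = true).card

/-- The multiplexer map `Γ_{T,C}`; `Sum.inr false` is `0*`, `Sum.inr true` is `1*`. -/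
noncomputable def Gamma {n s N : ℕ} (T : Fin N → Fin s → Fin n)
    (C : Fin N → Fin N → Fin s → Fin n) (x : Fin n → Bool) :
    (Fin N × Fin N) ⊕ Bool :=
  if h1 : ∃! i, Satisfies x (T i) then
    if h2 : ∃! j, Falsifies x (C (Classical.choose h1) j) then
      Sum.inl (Classical.choose h1, Classical.choose h2)
    else if ∃ j, Falsifies x (C (Classical.choose h1) j) then Sum.inr false
    else Sum.inr true
  else if ∃ i, Satisfies x (T i) then Sum.inr true
  else Sum.inr false

/-- The function `f_{T,C,h}`. -/
noncomputable def fTCH {n s N : ℕ} (T : Fin N → Fin s → Fin n)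
    (C : Fin N → Fin N → Fin s → Fin n)
    (h : Fin N → Fin N → (Fin n → Bool) → Bool) (x : Fin n → Bool) : Bool :=
  if ((n : ℝ) / 2 + s) < (weight x : ℝ) then true
  else if ((weight x : ℝ)) < ((n : ℝ) / 2 - s) then false
  else
    match Gamma T C x with
    | Sum.inl (i, j) => h i j x
    | Sum.inr b => b

theorem existsUnique_choose_eq_iff {α : Type*} {p : α → Prop} (h : ∃! a, p a) (a : α) :
    Classical.choose h = a ↔ p a := by
  have hc := Classical.choose_spec h
  exact ⟨fun e => e ▸ hc.1, fun ha => (hc.2 a ha).symm⟩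

theorem Gamma_eq_inl_iff {n s N : ℕ} (T : Fin N → Fin s → Fin n)
    (C : Fin N → Fin N → Fin s → Fin n) (x : Fin n → Bool) (i j : Fin N) :
    Gamma T C x = Sum.inl (i, j) ↔
      (∀ i', Satisfies x (T i') ↔ i' = i) ∧ ∀ j', Falsifies x (C i j') ↔ j' = j := by
  constructor
  · intro h
    unfold Gamma at h
    split_ifs at h with h1 h2
    obtain ⟨rfl, rfl⟩ := Prod.mk.inj (Sum.inl.inj h)
    exact ⟨fun i' => by rw [← existsUnique_choose_eq_iff h1, eq_comm],
      fun j' => by rw [← existsUnique_choose_eq_iff h2, eq_comm]⟩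
  · rintro ⟨hT, hC⟩
    have h1 : ∃! i, Satisfies x (T i) := ⟨i, (hT i).2 rfl, fun i' => (hT i').1⟩
    have e1 : Classical.choose h1 = i := (existsUnique_choose_eq_iff h1 i).2 ((hT i).2 rfl)
    have h2 : ∃! j, Falsifies x (C (Classical.choose h1) j) := by
      rw [e1]
      exact ⟨j, (hC j).2 rfl, fun j' => (hC j').1⟩
    have e2 : Classical.choose h2 = j :=
      (existsUnique_choose_eq_iff h2 j).2 (by rw [e1]; exact (hC j).2 rfl)
    rw [Gamma, dif_pos h1, dif_pos h2]
    exact congrArg Sum.inl (Prod.ext e1 e2)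

theorem flipCoord_of_ne {n : ℕ} (x : Fin n → Bool) {k l : Fin n} (h : l ≠ k) :
    flipCoord x k l = x l :=
  Function.update_of_ne h _ _

theorem le_flipCoord {n : ℕ} {x : Fin n → Bool} {k : Fin n} (hk : x k = false) :
    x ≤ flipCoord x k :=
  le_update_self_iff.2 (hk ▸ Bool.false_le _)

theorem Satisfies.mono {n s : ℕ} {x y : Fin n → Bool} {t : Fin s → Fin n}
    (h : Satisfies x t) (hxy : x ≤ y) : Satisfies y t :=
  fun m => hxy (t m) (h m)

theorem Falsifies.anti {n s : ℕ} {x y : Fin n → Bool} {c : Fin s → Fin n}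
    (h : Falsifies y c) (hxy : x ≤ y) : Falsifies x c :=
  fun m => Bool.eq_false_of_le_false ((hxy (c m)).trans_eq (h m))

/-- under events E₁ and E₂, flipping coordinate `k` keeps the
multiplexer value `(i, j)`. -/
theorem statement2 (n s N : ℕ) (T : Fin N → Fin s → Fin n)
    (C : Fin N → Fin N → Fin s → Fin n) (x : Fin n → Bool) (k : Fin n)
    (i j : Fin N)
    (hΓ : Gamma T C x = Sum.inl (i, j)) (hxk : x k = false)
    (hE1 : ∀ m : Fin s, C i j m ≠ k)
    (hE2 : ∀ i' : Fin N, i' ≠ i → ¬ Satisfies (flipCoord x k) (T i')) :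
    Gamma T C (flipCoord x k) = Sum.inl (i, j) := by
  rw [Gamma_eq_inl_iff] at hΓ ⊢
  obtain ⟨hT, hC⟩ := hΓ
  have hle := le_flipCoord hxk
  refine ⟨fun i' => ⟨fun h => by_contra fun hne => hE2 i' hne h,
    fun h => ((hT i').2 h).mono hle⟩, fun j' => ⟨fun h => (hC j').1 (h.anti hle), ?_⟩⟩
  rintro rfl m
  rw [flipCoord_of_ne x (hE1 m)]
  exact (hC j').2 rfl m
end

section
/- Fix naturals n, s, N with N ≥ 1, a string x : Fin n → Bool with exactly w coordinates equal to true, a coordinate k with x k = false, and an index j₀ : Fin N. Among all tuples C : Fin N → (Fin s → Fin n) (there are n^(s·N) of them), the number of tuples such that the flipped string x^(k) falsifies C j₀ and, for every j ≠ j₀, x does not falsify C j, equals (n − w − 1)^s · (n^s − (n − w)^s)^(N − 1). -/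
open scoped Classical

theorem filter_falsifies_eq_piFinset {n s : ℕ} (x : Fin n → Bool) :
    (Finset.univ.filter fun Cl : Fin s → Fin n => Falsifies x Cl)
      = Fintype.piFinset fun _ => Finset.univ.filter fun k => x k = false := by
  ext Cl
  rw [Finset.mem_filter]
  simp [Falsifies]

theorem card_filter_eq_false {n : ℕ} (x : Fin n → Bool) :
    (Finset.univ.filter fun k => x k = false).card = n - weight x := by
  have h := Finset.card_filter_add_card_filter_not (s := (Finset.univ : Finset (Fin n)))
    (fun k => x k = true)
  simp only [Bool.not_eq_true, Finset.card_univ, Fintype.card_fin] at h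
  unfold weight
  omega

theorem card_falsifies {n s : ℕ} (x : Fin n → Bool) :
    (Finset.univ.filter fun Cl : Fin s → Fin n => Falsifies x Cl).card
      = (n - weight x) ^ s := by
  rw [filter_falsifies_eq_piFinset, Fintype.card_piFinset]
  simp [card_filter_eq_false]

theorem card_not_falsifies {n s : ℕ} (x : Fin n → Bool)
    [DecidablePred fun Cl : Fin s → Fin n => ¬ Falsifies x Cl] :
    (Finset.univ.filter fun Cl : Fin s → Fin n => ¬ Falsifies x Cl).card
      = n ^ s - (n - weight x) ^ s := by
  have h := Finset.card_filter_add_card_filter_not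
    (s := (Finset.univ : Finset (Fin s → Fin n))) (fun Cl => Falsifies x Cl)
  rw [card_falsifies] at h
  simp only [Finset.card_univ, Fintype.card_fun, Fintype.card_fin] at h
  exact Nat.eq_sub_of_add_eq' h

theorem weight_flipCoord_of_eq_false {n : ℕ} {x : Fin n → Bool} {k : Fin n}
    (hk : x k = false) : weight (flipCoord x k) = weight x + 1 := by
  have h : (Finset.univ.filter fun i => flipCoord x k i = true)
      = insert k (Finset.univ.filter fun i => x i = true) := by
    ext i
    rw [Finset.mem_filter]
    by_cases hi : i = k
    · subst hi
      simp [flipCoord, hk]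
    · simp [flipCoord, hi]
  unfold weight
  rw [h, Finset.card_insert_of_notMem (by simp [hk])]

/-- Counting functions with one prescribed set of values at `j₀` and another elsewhere. -/
theorem card_filter_and_forall_ne {ι α : Type*} [Fintype ι] [Fintype α]
    (p q : α → Prop) (j₀ : ι) :
    (Finset.univ.filter fun f : ι → α => p (f j₀) ∧ ∀ j, j ≠ j₀ → q (f j)).card
      = (Finset.univ.filter p).card * (Finset.univ.filter q).card ^ (Fintype.card ι - 1) := by
  have h : (Finset.univ.filter fun f : ι → α => p (f j₀) ∧ ∀ j, j ≠ j₀ → q (f j))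
      = Fintype.piFinset fun j =>
          if j = j₀ then Finset.univ.filter p else Finset.univ.filter q := by
    ext f
    simp only [Finset.mem_filter, Finset.mem_univ, true_and, Fintype.mem_piFinset]
    constructor
    · rintro ⟨h₀, h₁⟩ j
      by_cases hj : j = j₀
      · subst hj
        simpa using h₀
      · simpa [hj] using h₁ j hj
    · intro hf
      refine ⟨by simpa using hf j₀, fun j hj => by simpa [hj] using hf j⟩
  rw [h, Fintype.card_piFinset, ← Finset.mul_prod_erase _ _ (Finset.mem_univ j₀), if_pos rfl,
    Finset.prod_congr rfl fun j hj => by rw [if_neg (Finset.ne_of_mem_erase hj)],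
    Finset.prod_const, Finset.card_erase_of_mem (Finset.mem_univ j₀), Finset.card_univ]

/-- exact count of tuples of clauses such that `x^(k)` falsifies
`C j₀` and `x` falsifies no other clause. -/
theorem statement7 (n s N w : ℕ) (hN : 1 ≤ N) (x : Fin n → Bool)
    (hw : weight x = w) (k : Fin n) (hk : x k = false) (j₀ : Fin N) :
    (Finset.univ.filter fun C : Fin N → Fin s → Fin n =>
        Falsifies (flipCoord x k) (C j₀) ∧ ∀ j : Fin N, j ≠ j₀ →
          ¬ Falsifies x (C j)).card
      = (n - w - 1) ^ s * (n ^ s - (n - w) ^ s) ^ (N - 1) := by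
  subst hw
  have h := card_filter_and_forall_ne (fun Cl : Fin s → Fin n => Falsifies (flipCoord x k) Cl)
    (fun Cl => ¬ Falsifies x Cl) j₀
  rw [card_falsifies, card_not_falsifies, weight_flipCoord_of_eq_false hk, Fintype.card_fin,
    ← Nat.sub_sub] at h
  convert h
end
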